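/- Let N ≥ 2 be an integer, g > 0, h > 0, u_m ∈ ℝ, and α₁ a nonzero real number. Then the matrix A^{HSWME} has N+2 pairwise distinct real eigenvalues, namely the numbers u_m + α₁·r for each of the N real roots r of P'_{N+1}, together with u_m + √(gh + α₁²) and u_m − √(gh + α₁²); in particular, A^{HSWME} is diagonalizable over ℝ. -/

import Mathlib

open Polynomial

/-- The Legendre polynomial of degree `n` (Rodrigues' formula), normalized so `P n 1 = 1`. -/
noncomputable def legendre (n : ℕ) : Polynomial ℝ :=
  ((2 ^ n * n.factorial : ℝ))⁻¹ • (derivative^[n] ((X ^ 2 - 1) ^ n))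

/-- Entry `(i,j)` (0-based) of the tridiagonal matrix `A₂`. -/
noncomputable def A2entry (α1 : ℝ) (i j : ℕ) : ℝ :=
  if j = i + 1 then ((i : ℝ) + 3) / (2 * (i : ℝ) + 5) * α1
  else if i = j + 1 then ((j : ℝ) + 1) / (2 * (j : ℝ) + 3) * α1
  else 0

/-- The HSWME system matrix in convective variables. -/
noncomputable def AHSWME (N : ℕ) (g h um α1 : ℝ) :
    Matrix (Fin (N + 2)) (Fin (N + 2)) ℝ := fun r c =>
  if r.val = 0 then (if c.val = 1 then 1 else 0)
  else if r.val = 1 then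
    (if c.val = 0 then g * h - um ^ 2 - α1 ^ 2 / 3
     else if c.val = 1 then 2 * um
     else if c.val = 2 then 2 / 3 * α1 else 0)
  else if c.val = 0 then
    (if r.val = 2 then -2 * um * α1 else if r.val = 3 then -(2 / 3) * α1 ^ 2 else 0)
  else if c.val = 1 then (if r.val = 2 then 2 * α1 else 0)
  else (if r = c then um else 0) + A2entry α1 (r.val - 2) (c.val - 2)

open scoped Matrix

/-- Rolle's theorem for finitely many roots of a polynomial in a closed interval. -/
theorem exists_finset_roots_derivative {p : ℝ[X]} (hp : derivative p ≠ 0) {a b : ℝ}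
    {s : Finset ℝ} (hs : ∀ x ∈ s, x ∈ Set.Icc a b ∧ p.eval x = 0) :
    ∃ t : Finset ℝ, (∀ x ∈ t, x ∈ Set.Ioo a b ∧ (derivative p).eval x = 0) ∧
      s.card ≤ t.card + 1 := by
  classical
  refine ⟨(derivative p).roots.toFinset.filter (· ∈ Set.Ioo a b), fun x hx => ?_,
    Finset.card_le_of_interleaved fun x hx y hy hxy _ => ?_⟩
  · simp only [Finset.mem_filter, Multiset.mem_toFinset, mem_roots hp, IsRoot.def] at hx
    exact hx.symm
  · obtain ⟨z, hz, hz'⟩ := exists_deriv_eq_zero hxy p.continuousOn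
      ((hs x hx).2.trans (hs y hy).2.symm)
    rw [Polynomial.deriv] at hz'
    refine ⟨z, ?_, hz⟩
    simp only [Finset.mem_filter, Multiset.mem_toFinset, mem_roots hp, IsRoot.def]
    exact ⟨hz', (hs x hx).1.1.trans_lt hz.1, hz.2.trans_le (hs y hy).1.2⟩

theorem iterate_derivative_ne_zero {p : ℝ[X]} (hp : p ≠ 0) {k : ℕ} (hk : k ≤ p.natDegree) :
    derivative^[k] p ≠ 0 := by
  intro h
  have := congrArg (coeff · (p.natDegree - k)) h
  simp only [coeff_iterate_derivative, Nat.sub_add_cancel hk, coeff_zero, smul_eq_zero,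
    Nat.descFactorial_eq_zero_iff_lt, coeff_natDegree, leadingCoeff_eq_zero] at this
  grind

theorem natDegree_X_sq_sub_one_pow (n : ℕ) : ((X ^ 2 - 1 : ℝ[X]) ^ n).natDegree = 2 * n := by
  rw [natDegree_pow, ← C_1, natDegree_X_pow_sub_C, mul_comm]

theorem X_sq_sub_one_pow_ne_zero (n : ℕ) : (X ^ 2 - 1 : ℝ[X]) ^ n ≠ 0 :=
  pow_ne_zero _ (by rw [← C_1]; exact X_pow_sub_C_ne_zero two_pos 1)

theorem eval_iterate_derivative_X_sq_sub_one_pow {n k : ℕ} (hk : k < n) {a : ℝ}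
    (ha : a ^ 2 = 1) : (derivative^[k] ((X ^ 2 - 1 : ℝ[X]) ^ n)).eval a = 0 := by
  have h1 : (X - C a : ℝ[X]) ∣ X ^ 2 - 1 := by
    rw [dvd_iff_isRoot]
    simp [ha]
  have h2 := pow_sub_dvd_iterate_derivative_of_pow_dvd k (pow_dvd_pow_of_dvd h1 n)
  exact dvd_iff_isRoot.1 ((dvd_pow_self _ (by omega)).trans h2)

theorem exists_finset_roots_iterate_derivative_X_sq_sub_one_pow {n k : ℕ} (hk : k ≤ n) :
    ∃ s : Finset ℝ, (∀ x ∈ s, x ∈ Set.Ioo (-1 : ℝ) 1 ∧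
      (derivative^[k] ((X ^ 2 - 1 : ℝ[X]) ^ n)).eval x = 0) ∧ k ≤ s.card := by
  induction k with
  | zero => exact ⟨∅, by simp⟩
  | succ k ih =>
    obtain ⟨s, hs, hks⟩ := ih (by omega)
    have hne : derivative (derivative^[k] ((X ^ 2 - 1 : ℝ[X]) ^ n)) ≠ 0 := by
      rw [← Function.iterate_succ_apply' derivative]
      exact iterate_derivative_ne_zero (X_sq_sub_one_pow_ne_zero n)
        (by rw [natDegree_X_sq_sub_one_pow]; omega)
    obtain ⟨t, ht, hst⟩ := exists_finset_roots_derivative (a := -1) (b := 1)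
      (s := insert (-1) (insert 1 s)) hne (by
        simp only [Finset.mem_insert]
        rintro x (rfl | rfl | hx)
        · exact ⟨by norm_num, eval_iterate_derivative_X_sq_sub_one_pow hk (by norm_num)⟩
        · exact ⟨by norm_num, eval_iterate_derivative_X_sq_sub_one_pow hk (by norm_num)⟩
        · exact ⟨Set.Ioo_subset_Icc_self (hs x hx).1, (hs x hx).2⟩)
    refine ⟨t, by simpa only [Function.iterate_succ_apply'] using ht, ?_⟩
    have h1 : (1 : ℝ) ∉ s := fun h => absurd (hs _ h).1.2 (lt_irrefl _)
    have h2 : (-1 : ℝ) ∉ insert 1 s := by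
      rw [Finset.mem_insert, not_or]
      exact ⟨by norm_num, fun h => absurd (hs _ h).1.1 (lt_irrefl _)⟩
    rw [Finset.card_insert_of_notMem h2, Finset.card_insert_of_notMem h1] at hst
    omega

theorem derivative_legendre (n : ℕ) : derivative (legendre n) =
    ((2 ^ n * n.factorial : ℝ))⁻¹ • derivative^[n + 1] ((X ^ 2 - 1) ^ n) := by
  rw [legendre, derivative_smul, Function.iterate_succ_apply']

theorem derivative_legendre_succ_ne_zero (N : ℕ) : derivative (legendre (N + 1)) ≠ 0 := by
  rw [derivative_legendre]
  exact smul_ne_zero (by positivity) (iterate_derivative_ne_zero (X_sq_sub_one_pow_ne_zero _)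
    (by rw [natDegree_X_sq_sub_one_pow]; omega))

/-- The derivative of the Legendre polynomial of degree `N + 1` has exactly `N` real roots, all
of them in `(-1, 1)`. -/
theorem exists_finset_roots_derivative_legendre (N : ℕ) :
    ∃ t : Finset ℝ, (∀ r, r ∈ t ↔ (derivative (legendre (N + 1))).eval r = 0) ∧
      (∀ r ∈ t, r ∈ Set.Ioo (-1 : ℝ) 1) ∧ t.card = N := by
  classical
  have hne := derivative_legendre_succ_ne_zero N
  obtain ⟨s, hs, hNs⟩ :=
    exists_finset_roots_iterate_derivative_X_sq_sub_one_pow (le_refl (N + 1))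
  obtain ⟨t, ht, hst⟩ := exists_finset_roots_derivative (p := legendre (N + 1)) (s := s) hne
    fun x hx => ⟨Set.Ioo_subset_Icc_self (hs x hx).1, by
      rw [legendre, eval_smul, (hs x hx).2, smul_zero]⟩
  have hsub : t ⊆ (derivative (legendre (N + 1))).roots.toFinset := fun x hx => by
    rw [Multiset.mem_toFinset, mem_roots hne]
    exact (ht x hx).2
  have hdeg : (derivative (legendre (N + 1))).roots.toFinset.card ≤ N := by
    refine (Multiset.toFinset_card_le _).trans ((card_roots' _).trans ?_)
    rw [derivative_legendre]
    refine (natDegree_smul_le _ _).trans ((natDegree_iterate_derivative _ _).trans ?_)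
    rw [natDegree_X_sq_sub_one_pow]
    omega
  have heq := Finset.eq_of_subset_of_card_le hsub (by omega)
  refine ⟨t, fun r => ?_, fun r hr => (ht r hr).1, ?_⟩
  · rw [heq, Multiset.mem_toFinset, mem_roots hne, IsRoot.def]
  · have := Finset.card_le_card hsub
    omega

theorem iterate_derivative_succ_X_mul (p : ℝ[X]) (n : ℕ) : derivative^[n + 1] (X * p) =
    X * derivative^[n + 1] p + (n + 1 : ℝ) • derivative^[n] p := by
  induction n with
  | zero => simp; ring
  | succ n ih =>
    rw [Function.iterate_succ_apply', ih]
    simp only [derivative_add, derivative_smul, derivative_mul, derivative_X, one_mul,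
      ← Function.iterate_succ_apply' derivative]
    push_cast
    module

theorem derivative_X_sq_sub_one_pow_succ (n : ℕ) :
    derivative ((X ^ 2 - 1 : ℝ[X]) ^ (n + 1)) =
      (2 * (n + 1) : ℝ) • (X * (X ^ 2 - 1) ^ n) := by
  rw [derivative_pow_succ, smul_eq_C_mul]
  simp [map_ofNat C]
  ring

theorem derivative_derivative_X_sq_sub_one_pow (n : ℕ) :
    derivative (derivative ((X ^ 2 - 1 : ℝ[X]) ^ (n + 2))) =
      (2 * (n + 2) : ℝ) • ((2 * n + 3 : ℝ) • (X ^ 2 - 1) ^ (n + 1) +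
        (2 * (n + 1) : ℝ) • (X ^ 2 - 1) ^ n) := by
  rw [derivative_X_sq_sub_one_pow_succ, derivative_smul, derivative_mul,
    derivative_X_sq_sub_one_pow_succ]
  simp only [smul_eq_C_mul]
  simp [map_ofNat C]
  ring

theorem derivative_legendre_succ (n : ℕ) : derivative (legendre (n + 1)) =
    X * derivative (legendre n) + (n + 1 : ℝ) • legendre n := by
  have hc : ((2 ^ (n + 1) * (n + 1).factorial : ℝ))⁻¹ * (2 * (n + 1)) =
      ((2 ^ n * n.factorial : ℝ))⁻¹ := by
    rw [Nat.factorial_succ]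
    push_cast
    field_simp
    ring
  rw [derivative_legendre, Function.iterate_succ_apply, derivative_X_sq_sub_one_pow_succ,
    iterate_derivative_smul, iterate_derivative_succ_X_mul, smul_smul, hc, derivative_legendre,
    legendre, smul_add, mul_smul_comm, smul_comm]

theorem derivative_legendre_add_two (n : ℕ) : derivative (legendre (n + 2)) =
    (2 * n + 3 : ℝ) • legendre (n + 1) + derivative (legendre n) := by
  have hc : ((2 ^ (n + 2) * (n + 2).factorial : ℝ))⁻¹ * (2 * (n + 2)) =
      ((2 ^ (n + 1) * (n + 1).factorial : ℝ))⁻¹ := by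
    rw [Nat.factorial_succ (n + 1)]
    push_cast
    field_simp
    ring
  have hc' : ((2 ^ (n + 1) * (n + 1).factorial : ℝ))⁻¹ * (2 * (n + 1)) =
      ((2 ^ n * n.factorial : ℝ))⁻¹ := by
    rw [Nat.factorial_succ]
    push_cast
    field_simp
    ring
  rw [derivative_legendre, Function.iterate_succ_apply, Function.iterate_succ_apply,
    derivative_derivative_X_sq_sub_one_pow,
    iterate_derivative_smul, iterate_map_add, iterate_derivative_smul,
    iterate_derivative_smul, smul_smul, hc, smul_add, smul_smul _ (2 * (n + 1) : ℝ), hc',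
    derivative_legendre, legendre, smul_comm]

theorem eval_derivative_legendre_recurrence (n : ℕ) (x : ℝ) :
    (n + 1 : ℝ) * (derivative (legendre (n + 2))).eval x =
      (2 * n + 3) * x * (derivative (legendre (n + 1))).eval x -
        (n + 2) * (derivative (legendre n)).eval x := by
  have h1 := congrArg (eval x) (derivative_legendre_succ (n + 1))
  have h2 := congrArg (eval x) (derivative_legendre_add_two n)
  simp only [eval_add, eval_mul, eval_X, eval_smul, smul_eq_mul] at h1 h2
  push_cast at h1
  linear_combination (2 * n + 3) * h1 - (n + 2) * h2

/-- The solution with initial values `1, 0` of the recurrence satisfied by the derivatives of the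
Legendre polynomials. -/
noncomputable def associatedLegendreDerivative (x : ℝ) : ℕ → ℝ
  | 0 => 1
  | 1 => 0
  | n + 2 => ((2 * n + 3) * x * associatedLegendreDerivative x (n + 1) -
      (n + 2) * associatedLegendreDerivative x n) / (n + 1)

theorem exists_recurrence_solution (x a b : ℝ) : ∃ p : ℕ → ℝ, p 0 = a ∧ p 1 = b ∧
    (∀ n : ℕ, (n + 1 : ℝ) * p (n + 2) = (2 * n + 3) * x * p (n + 1) - (n + 2) * p n) ∧
    ∀ n, p n = b * (derivative (legendre n)).eval x + a * associatedLegendreDerivative x n := by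
  refine ⟨fun n => b * (derivative (legendre n)).eval x + a * associatedLegendreDerivative x n,
    ?_, ?_, fun n => ?_, fun _ => rfl⟩
  · simp [legendre, associatedLegendreDerivative]
  · have : (derivative (legendre 1)).eval x = 1 := by
      rw [derivative_legendre_succ]
      simp [legendre]
    simp [associatedLegendreDerivative, this]
  · have h1 := eval_derivative_legendre_recurrence n x
    have h2 : (n + 1 : ℝ) * associatedLegendreDerivative x (n + 2) =
        (2 * n + 3) * x * associatedLegendreDerivative x (n + 1) -
          (n + 2) * associatedLegendreDerivative x n := by
      rw [associatedLegendreDerivative]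
      field_simp
    linear_combination b * h1 + a * h2

theorem sum_range_eq_three {M a : ℕ} (ha : a + 2 < M) {F : ℕ → ℝ}
    (hF : ∀ r, r < a ∨ a + 2 < r → F r = 0) :
    ∑ r ∈ Finset.range M, F r = F a + F (a + 1) + F (a + 2) := by
  have hsub : Finset.Ico a (a + 3) ⊆ Finset.range M := fun r hr => by
    simp only [Finset.mem_Ico, Finset.mem_range] at *
    omega
  rw [← Finset.sum_subset hsub fun r _ hr => hF r (by simp only [Finset.mem_Ico] at hr; omega),
    Finset.sum_Ico_eq_sum_range]
  simp [Finset.sum_range_succ]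

/-- Entry `(r, c)` (0-based) of `AHSWME`, as a function on natural numbers. -/
noncomputable def AHSWMEentry (g h um α1 : ℝ) (r c : ℕ) : ℝ :=
  if r = 0 then (if c = 1 then 1 else 0)
  else if r = 1 then
    (if c = 0 then g * h - um ^ 2 - α1 ^ 2 / 3
     else if c = 1 then 2 * um
     else if c = 2 then 2 / 3 * α1 else 0)
  else if c = 0 then
    (if r = 2 then -2 * um * α1 else if r = 3 then -(2 / 3) * α1 ^ 2 else 0)
  else if c = 1 then (if r = 2 then 2 * α1 else 0)
  else (if r = c then um else 0) + A2entry α1 (r - 2) (c - 2)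

theorem AHSWME_apply {N : ℕ} (g h um α1 : ℝ) (r c : Fin (N + 2)) :
    AHSWME N g h um α1 r c = AHSWMEentry g h um α1 r c := by
  simp only [AHSWME, AHSWMEentry, Fin.ext_iff]

theorem AHSWMEentry_add_two_eq_zero (g h um α1 : ℝ) {r k : ℕ} (hr : r < k + 1 ∨ k + 3 < r) :
    AHSWMEentry g h um α1 r (k + 2) = 0 := by
  simp only [AHSWMEentry, A2entry]
  split_ifs <;> first | contradiction | omega | simp

/-- Candidate left eigenvector of `AHSWME`, built from a solution `p` of the Legendre derivative
recurrence. -/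
def leftVec (d : ℝ) (p : ℕ → ℝ) : ℕ → ℝ
  | 0 => d
  | n + 1 => p n

theorem vecMul_AHSWME_leftVec {N : ℕ} (hN : 2 ≤ N) {g h um α1 x : ℝ} {p : ℕ → ℝ}
    (hp : ∀ n : ℕ, (n + 1 : ℝ) * p (n + 2) = (2 * n + 3) * x * p (n + 1) - (n + 2) * p n)
    (hpN : p (N + 1) = 0) (hp0 : p 0 * (g * h + α1 ^ 2 - (α1 * x) ^ 2) = 0) :
    (fun i : Fin (N + 2) => leftVec ((α1 * x - um) * p 0 - 2 * α1 * p 1) p i) ᵥ*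
        AHSWME N g h um α1 =
      (um + α1 * x) • fun i : Fin (N + 2) =>
        leftVec ((α1 * x - um) * p 0 - 2 * α1 * p 1) p i := by
  set v := leftVec ((α1 * x - um) * p 0 - 2 * α1 * p 1) p with hv
  ext ⟨c, hc⟩
  simp only [Matrix.vecMul, dotProduct, AHSWME_apply, Pi.smul_apply, smul_eq_mul]
  rw [Fin.sum_univ_eq_sum_range fun r => v r * AHSWMEentry g h um α1 r c]
  have hlast : ∑ r ∈ Finset.range (N + 2), v r * AHSWMEentry g h um α1 r c =
      ∑ r ∈ Finset.range (N + 3), v r * AHSWMEentry g h um α1 r c := by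
    rw [Finset.sum_range_succ _ (N + 2)]
    simp [hv, leftVec, hpN]
  rw [hlast]
  have h0 := hp 0
  push_cast at h0
  match c, hc with
  | 0, _ =>
    rw [sum_range_eq_three (a := 1) (by omega) fun r hr => by
      simp only [AHSWMEentry]
      grind]
    simp [AHSWMEentry, hv, leftVec]
    linear_combination hp0 - 2 / 3 * α1 ^ 2 * h0
  | 1, _ =>
    rw [sum_range_eq_three (a := 0) (by omega) fun r hr => by
      simp only [AHSWMEentry]
      grind]
    simp [AHSWMEentry, hv, leftVec]
    ring
  | 2, _ =>
    rw [sum_range_eq_three (a := 1) (by omega) fun r hr => by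
      rw [AHSWMEentry_add_two_eq_zero g h um α1 (by omega), mul_zero]]
    simp [AHSWMEentry, A2entry, hv, leftVec]
    linear_combination α1 / 3 * h0
  | c + 3, hc =>
    rw [sum_range_eq_three (a := c + 2) (by omega) fun r hr => by
      rw [AHSWMEentry_add_two_eq_zero g h um α1 (by omega), mul_zero]]
    have h1 := hp (c + 1)
    simp [AHSWMEentry, A2entry, hv, leftVec]
    push_cast at h1
    field_simp
    linear_combination α1 * (2 * c + 5) * h1

/-- If `v` is a family of left eigenvectors for pairwise distinct eigenvalues, as many as the size
of the matrix, then the matrix is diagonalizable and they are all of its spectrum. -/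
theorem spectrum_and_diagonalizable_of_left_eigenvectors {n : ℕ} (A : Matrix (Fin n) (Fin n) ℝ)
    {T : Finset ℝ} (hT : T.card = n)
    (hA : ∀ μ ∈ T, ∃ v : Fin n → ℝ, v ≠ 0 ∧ v ᵥ* A = μ • v) :
    spectrum ℝ A = T ∧ ∃ P D : Matrix (Fin n) (Fin n) ℝ,
      IsUnit P ∧ D.IsDiag ∧ A = P * D * P⁻¹ := by
  let μ := T.orderEmbOfFin hT
  choose v hv0 hv using fun i => hA (μ i) (T.orderEmbOfFin_mem hT i)
  have hli : LinearIndependent ℝ v :=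
    Module.End.eigenvectors_linearIndependent' A.vecMulLinear μ μ.injective v fun i =>
      Module.End.hasEigenvector_iff.2 ⟨Module.End.mem_eigenspace_iff.2 (hv i), hv0 i⟩
  let V : Matrix (Fin n) (Fin n) ℝ := Matrix.of v
  have hV : IsUnit V := Matrix.linearIndependent_rows_iff_isUnit.1 hli
  have hdet : IsUnit V.det := (Matrix.isUnit_iff_isUnit_det V).1 hV
  have hVA : V * A = Matrix.diagonal μ * V := by
    ext i j
    rw [Matrix.diagonal_mul]
    exact congrFun (hv i) j
  have hAV : A = V⁻¹ * Matrix.diagonal μ * V⁻¹⁻¹ := by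
    rw [Matrix.nonsing_inv_nonsing_inv V hdet, mul_assoc, ← hVA, ← mul_assoc,
      Matrix.nonsing_inv_mul V hdet, one_mul]
  have hVinv : IsUnit V⁻¹ := Matrix.isUnit_nonsing_inv_iff.2 hV
  refine ⟨?_, V⁻¹, Matrix.diagonal μ, hVinv, Matrix.isDiag_diagonal _, hAV⟩
  obtain ⟨u, hu⟩ := hVinv
  rw [hAV, ← hu, ← Matrix.coe_units_inv, spectrum.units_conjugate, spectrum_diagonal]
  exact T.range_orderEmbOfFin hT

theorem exists_left_eigenvector_of_derivative_legendre_root {N : ℕ} (hN : 2 ≤ N)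
    (g h um α1 : ℝ) {x : ℝ} (hx : (derivative (legendre (N + 1))).eval x = 0) :
    ∃ v : Fin (N + 2) → ℝ, v ≠ 0 ∧ v ᵥ* AHSWME N g h um α1 = (um + α1 * x) • v := by
  obtain ⟨p, hp0, hp1, hp, hsol⟩ := exists_recurrence_solution x 0 1
  refine ⟨_, fun h0 => ?_, vecMul_AHSWME_leftVec hN hp (by simp [hsol, hx]) (by simp [hp0])⟩
  have := congrFun h0 ⟨2, by omega⟩
  simp [leftVec, hp1] at this

theorem exists_left_eigenvector_of_sq_eq {N : ℕ} (hN : 2 ≤ N) {g h um α1 x : ℝ}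
    (hx : (derivative (legendre (N + 1))).eval x ≠ 0) (hsq : (α1 * x) ^ 2 = g * h + α1 ^ 2) :
    ∃ v : Fin (N + 2) → ℝ, v ≠ 0 ∧ v ᵥ* AHSWME N g h um α1 = (um + α1 * x) • v := by
  obtain ⟨p, hp0, hp1, hp, hsol⟩ := exists_recurrence_solution x 1
    (-associatedLegendreDerivative x (N + 1) / (derivative (legendre (N + 1))).eval x)
  refine ⟨_, fun h0 => ?_, vecMul_AHSWME_leftVec hN hp ?_ ?_⟩
  · have := congrFun h0 ⟨1, by omega⟩
    simp [leftVec, hp0] at this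
  · rw [hsol]
    field_simp
    ring
  · rw [hsq, sub_self, mul_zero]

/-- The HSWME system matrix has `N+2` pairwise distinct real eigenvalues: `u_m + α₁·r` for
the `N` real roots `r` of `P'_{N+1}`, together with `u_m ± √(gh + α₁²)`; in particular it is
real diagonalizable. -/
theorem stmt_4 (N : ℕ) (hN : 2 ≤ N) (g h um α1 : ℝ) (hg : 0 < g) (hh : 0 < h)
    (hα1 : α1 ≠ 0) :
    spectrum ℝ (AHSWME N g h um α1) =
        ((fun r => um + α1 * r) '' {r : ℝ | (derivative (legendre (N + 1))).eval r = 0}) ∪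
          {um + Real.sqrt (g * h + α1 ^ 2), um - Real.sqrt (g * h + α1 ^ 2)} ∧
      (spectrum ℝ (AHSWME N g h um α1)).ncard = N + 2 ∧
      ∃ P D : Matrix (Fin (N + 2)) (Fin (N + 2)) ℝ,
        IsUnit P ∧ D.IsDiag ∧ AHSWME N g h um α1 = P * D * P⁻¹ := by
  classical
  obtain ⟨t, ht, htIoo, htc⟩ := exists_finset_roots_derivative_legendre N
  have hpos : 0 < g * h + α1 ^ 2 := by positivity
  have hgt : |α1| < √(g * h + α1 ^ 2) := by
    refine Real.lt_sqrt_of_sq_lt ?_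
    rw [sq_abs]
    linarith [mul_pos hg hh]
  have hlt : ∀ r ∈ t, |α1 * r| < √(g * h + α1 ^ 2) := fun r hr => by
    rw [abs_mul]
    exact (mul_le_of_le_one_right (abs_nonneg _) (abs_lt.2 (htIoo r hr)).le).trans_lt hgt
  set s := √(g * h + α1 ^ 2) with hs
  have hs2 : s ^ 2 = g * h + α1 ^ 2 := Real.sq_sqrt hpos.le
  have hs0 : 0 < s := Real.sqrt_pos.2 hpos
  let T : Finset ℝ := t.image (fun r => um + α1 * r) ∪ {um + s, um - s}
  have hT : (T : Set ℝ) = ((fun r => um + α1 * r) ''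
      {r : ℝ | (derivative (legendre (N + 1))).eval r = 0}) ∪ {um + s, um - s} := by
    have : (t : Set ℝ) = {r : ℝ | (derivative (legendre (N + 1))).eval r = 0} := Set.ext ht
    simp [T, this]
  have hTc : T.card = N + 2 := by
    rw [Finset.card_union_of_disjoint, Finset.card_image_of_injective _ fun a b hab => ?_, htc,
      Finset.card_pair (by linarith)]
    · exact mul_left_cancel₀ hα1 (add_left_cancel hab)
    · refine Finset.disjoint_left.2 fun y hy hy' => ?_
      obtain ⟨r, hr, rfl⟩ := Finset.mem_image.1 hy
      have := abs_lt.1 (hlt r hr)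
      rw [Finset.mem_insert, Finset.mem_singleton] at hy'
      rcases hy' with h | h <;> linarith
  have hbig : ∀ y, y ^ 2 = s ^ 2 → ∃ v : Fin (N + 2) → ℝ, v ≠ 0 ∧
      v ᵥ* AHSWME N g h um α1 = (um + y) • v := fun y hy => by
    have hxy : α1 * (y / α1) = y := mul_div_cancel₀ y hα1
    have := exists_left_eigenvector_of_sq_eq hN (g := g) (h := h) (um := um) (α1 := α1)
      (x := y / α1) (fun h0 => ?_) (by rw [hxy, hy, hs2])
    · rwa [hxy] at this
    · have h1 := hlt _ ((ht _).2 h0)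
      rw [hxy, ← abs_of_pos hs0, ← sq_lt_sq] at h1
      exact h1.ne hy
  obtain ⟨hspec, hdiag⟩ := spectrum_and_diagonalizable_of_left_eigenvectors
    (AHSWME N g h um α1) hTc fun μ hμ => by
      rw [Finset.mem_union, Finset.mem_image, Finset.mem_insert, Finset.mem_singleton] at hμ
      rcases hμ with ⟨r, hr, rfl⟩ | rfl | rfl
      · exact exists_left_eigenvector_of_derivative_legendre_root hN g h um α1 ((ht r).1 hr)
      · exact hbig s rfl
      · exact hbig (-s) (neg_sq s)
  exact ⟨hspec.trans hT, by rw [hspec, Set.ncard_coe_finset, hTc], hdiag⟩
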